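/- arXiv:1612.01149 — 4 statements merged into one kernel-verified Lean document; each statement's English description precedes it below -/
import Mathlib

section
/- For each k ∈ {0,…,p−1} and every integer n ≥ 0, the difference Z(n+1,k) − Z(n,k) belongs to {−1, 0, 1}. -/
noncomputable section

/-- The quantity `Z(n,k) = Σ_{j=k}^{p-1} M_j(n)`, where `M_j(n)` is the number of
integers `s` with `⌈(ℓ(n)-j)/(p+1)⌉ ≤ s ≤ ⌊(n + p·ℓ(n) - 1 - j(p+1))/(p(p+1))⌋`
and `ℓ(n) = n % (p+1)`.  In particular `Z(n,p) = 0`. -/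
def Zdeg (p n k : ℕ) : ℕ :=
  ∑ j ∈ Finset.Ico k p,
    (Finset.Icc
      (⌈(((n % (p + 1) : ℕ) : ℚ) - (j : ℚ)) / ((p : ℚ) + 1)⌉)
      (⌊((n : ℚ) + (p : ℚ) * ((n % (p + 1) : ℕ) : ℚ) - 1 - (j : ℚ) * ((p : ℚ) + 1)) /
          ((p : ℚ) * ((p : ℚ) + 1))⌋)).card

lemma Mterm (p a l j : ℕ) (hl : l ≤ p) (hj : j < p) :
    (((Finset.Icc
      (⌈(((l : ℕ) : ℚ) - (j : ℚ)) / ((p : ℚ) + 1)⌉)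
      (⌊(((a * (p + 1) + l : ℕ) : ℚ) + (p : ℚ) * ((l : ℕ) : ℚ) - 1 - (j : ℚ) * ((p : ℚ) + 1)) /
          ((p : ℚ) * ((p : ℚ) + 1))⌋)).card : ℕ) : ℤ)
      = ((a : ℤ) + l - j - 1) / p + 1 - (if j < l then 1 else 0) := by
  have hp : (0 : ℤ) < p := by omega
  have hpq : (0 : ℚ) < p := by exact_mod_cast hp
  have h1 : ⌈(((l : ℕ) : ℚ) - (j : ℚ)) / ((p : ℚ) + 1)⌉ = if j < l then 1 else 0 := by
    have hlq : (l : ℚ) ≤ p := by exact_mod_cast hl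
    have hjq : (j : ℚ) + 1 ≤ p := by exact_mod_cast hj
    have hl0 : (0 : ℚ) ≤ l := by positivity
    have hj0 : (0 : ℚ) ≤ j := by positivity
    split_ifs with h
    · have hq : (j : ℚ) < l := by exact_mod_cast h
      rw [Int.ceil_eq_iff, lt_div_iff₀ (by positivity), div_le_iff₀ (by positivity)]
      push_cast
      constructor <;> linarith
    · have hq : (l : ℚ) ≤ j := by exact_mod_cast not_lt.mp h
      rw [Int.ceil_eq_iff, lt_div_iff₀ (by positivity), div_le_iff₀ (by positivity)]
      push_cast
      constructor <;> linarith
  have h2 : ⌊(((a * (p + 1) + l : ℕ) : ℚ) + (p : ℚ) * ((l : ℕ) : ℚ) - 1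
      - (j : ℚ) * ((p : ℚ) + 1)) / ((p : ℚ) * ((p : ℚ) + 1))⌋
      = ((a : ℤ) + l - j - 1) / p := by
    have e1 := Int.emod_nonneg ((a : ℤ) + l - j - 1) hp.ne'
    have e2 := Int.emod_lt_of_pos ((a : ℤ) + l - j - 1) hp
    have e3 := Int.mul_ediv_add_emod ((a : ℤ) + l - j - 1) p
    set q := ((a : ℤ) + l - j - 1) / p
    have g1 : (p : ℤ) * q ≤ (a : ℤ) + l - j - 1 := by linarith
    have g2 : (a : ℤ) + l - j ≤ p * q + p := by linarith
    have g1q : (p : ℚ) * q ≤ (a : ℚ) + l - j - 1 := by exact_mod_cast g1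
    have g2q : (a : ℚ) + l - j ≤ p * q + p := by exact_mod_cast g2
    rw [Int.floor_eq_iff, le_div_iff₀ (by positivity), div_lt_iff₀ (by positivity)]
    push_cast
    constructor <;> nlinarith
  rw [h1, h2, Int.card_Icc]
  have h3 : (if j < l then (1 : ℤ) else 0) - 1 ≤ ((a : ℤ) + l - j - 1) / p := by
    rw [Int.le_ediv_iff_mul_le hp]
    split_ifs <;> omega
  omega

lemma Zform (p a l k : ℕ) (hl : l ≤ p) :
    (Zdeg p (a * (p + 1) + l) k : ℤ) =
      ∑ j ∈ Finset.Ico k p,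
        (((a : ℤ) + l - j - 1) / p + 1 - (if j < l then 1 else 0)) := by
  have hm : (a * (p + 1) + l) % (p + 1) = l := by
    rw [Nat.mul_add_mod', Nat.mod_eq_of_lt (by omega)]
  unfold Zdeg
  rw [hm, Nat.cast_sum]
  refine Finset.sum_congr rfl fun j hj => ?_
  exact Mterm p a l j hl (Finset.mem_Ico.mp hj).2

lemma tele (p k : ℕ) (hk : k < p) (x : ℤ) :
    0 ≤ ∑ j ∈ Finset.Ico k p, ((x - j) / p - (x - j - 1) / p) ∧
    ∑ j ∈ Finset.Ico k p, ((x - j) / p - (x - j - 1) / p) ≤ 1 := by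
  have hp : (0 : ℤ) < p := by omega
  have key : ∀ m, k ≤ m → ∑ j ∈ Finset.Ico k m, ((x - j) / p - (x - j - 1) / p)
      = (x - k) / p - (x - m) / p := by
    intro m hm
    induction m, hm using Nat.le_induction with
    | base => simp
    | succ m hm ih =>
      rw [Finset.sum_Ico_succ_top hm, ih]
      push_cast
      rw [sub_sub x (m : ℤ) 1]
      ring
  rw [key p hk.le]
  have e : (x - p) / (p : ℤ) = x / p - 1 := by
    rw [Int.sub_ediv_of_dvd _ (dvd_refl _), Int.ediv_self hp.ne']
  have u : (x - k) / (p : ℤ) ≤ x / p := Int.ediv_le_ediv hp (by omega)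
  have v : (x - p) / (p : ℤ) ≤ (x - k) / p := Int.ediv_le_ediv hp (by omega)
  omega

/-- **The difference `Z(n+1,k) - Z(n,k)` takes only the values `-1, 0, 1`**
(part of Lemma `lem:valuesdiffZnk`). -/
theorem Zdeg_diff_mem (p : ℕ) (hp : 1 ≤ p) (k : ℕ) (hk : k < p) (n : ℕ) :
    (Zdeg p (n + 1) k : ℤ) - (Zdeg p n k : ℤ) = -1 ∨
    (Zdeg p (n + 1) k : ℤ) - (Zdeg p n k : ℤ) = 0 ∨
    (Zdeg p (n + 1) k : ℤ) - (Zdeg p n k : ℤ) = 1 := by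
  obtain ⟨a, l, hl, rfl⟩ : ∃ a l, l ≤ p ∧ n = a * (p + 1) + l :=
    ⟨n / (p + 1), n % (p + 1), Nat.lt_succ_iff.mp (Nat.mod_lt _ (by omega)),
      (Nat.div_add_mod' n (p + 1)).symm⟩
  have hp0 : (p : ℤ) ≠ 0 := by omega
  rcases hl.lt_or_eq with h | rfl
  · have t := tele p k hk (a + l)
    have hd : (Zdeg p (a * (p + 1) + l + 1) k : ℤ) - (Zdeg p (a * (p + 1) + l) k : ℤ)
        = ∑ j ∈ Finset.Ico k p, (((a : ℤ) + l - j) / p - ((a : ℤ) + l - j - 1) / p)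
          - ∑ j ∈ Finset.Ico k p, (if j = l then (1 : ℤ) else 0) := by
      rw [add_assoc, Zform p a (l + 1) k h, Zform p a l k hl, ← Finset.sum_sub_distrib,
        ← Finset.sum_sub_distrib]
      refine Finset.sum_congr rfl fun j _ => ?_
      have : (a : ℤ) + (l + 1 : ℕ) - j - 1 = a + l - j := by push_cast; ring
      rw [this]
      split_ifs <;> omega
    rw [Finset.sum_ite_eq'] at hd
    rw [hd]
    split_ifs <;> omega
  · have t := tele l k hk a
    have hd : (Zdeg l (a * (l + 1) + l + 1) k : ℤ) - (Zdeg l (a * (l + 1) + l) k : ℤ)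
        = ∑ j ∈ Finset.Ico k l, (((a : ℤ) - j) / l - ((a : ℤ) - j - 1) / l) := by
      have e : a * (l + 1) + l + 1 = (a + 1) * (l + 1) + 0 := by ring
      rw [e, Zform l (a + 1) 0 k (by omega), Zform l a l k le_rfl, ← Finset.sum_sub_distrib]
      refine Finset.sum_congr rfl fun j hj => ?_
      have e1 : ((a + 1 : ℕ) : ℤ) + (0 : ℕ) - j - 1 = a - j := by push_cast; ring
      have e2 : (a : ℤ) + l - j - 1 = (a - j - 1) + l := by ring
      rw [e1, e2, Int.add_ediv_of_dvd_right (dvd_refl _), Int.ediv_self hp0,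
        if_pos (Finset.mem_Ico.mp hj).2, if_neg (by omega)]
      ring
    omega

end
end

section
/- Let k ∈ {0,…,p−1} and let n ≥ 0 be an integer with ℓ(n) ∈ {0,…,p−1}. Then Z(n+1,k) − Z(n,k) equals: 0 if ℓ(n) ∈ {0,…,k−1} and η(n)+ℓ(n) ∉ {k,…,p−1}; 1 if ℓ(n) ∈ {0,…,k−1} and η(n)+ℓ(n) ∈ {k,…,p−1}; 0 if ℓ(n) ∈ {k,…,p−1} and η(n)+ℓ(n) ∉ {p,…,p+k−1}; and −1 if ℓ(n) ∈ {k,…,p−1} and η(n)+ℓ(n) ∈ {p,…,p+k−1}. -/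
noncomputable section

lemma Zdeg_card_aux (p n j L e l : ℕ) (hj : j < p) (hl : l ≤ p) (he : e < p)
    (hn : n = L * (p * (p + 1)) + e * (p + 1) + l) :
    (((Finset.Icc
      (⌈((l : ℚ) - (j : ℚ)) / ((p : ℚ) + 1)⌉)
      (⌊((n : ℚ) + (p : ℚ) * (l : ℚ) - 1 - (j : ℚ) * ((p : ℚ) + 1)) /
          ((p : ℚ) * ((p : ℚ) + 1))⌋)).card : ℕ) : ℤ) =
      (L : ℤ) + (if j < e + l then 1 else 0) + (if p + j < e + l then 1 else 0)
        - (if j < l then 1 else 0) := by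
  have hp0 : (0 : ℚ) < p := by exact_mod_cast (by omega : 0 < p)
  have hp1 : (0 : ℚ) < (p : ℚ) + 1 := by positivity
  have hc : ⌈((l : ℚ) - (j : ℚ)) / ((p : ℚ) + 1)⌉ = if j < l then 1 else 0 := by
    have hl' : (l : ℚ) ≤ p := by exact_mod_cast hl
    have hj' : (j : ℚ) + 1 ≤ p := by exact_mod_cast hj
    have hl0 : (0 : ℚ) ≤ l := by positivity
    have hj0 : (0 : ℚ) ≤ j := by positivity
    rw [Int.ceil_eq_iff, lt_div_iff₀ hp1, div_le_iff₀ hp1]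
    split_ifs with h
    · have : (j : ℚ) + 1 ≤ l := by exact_mod_cast h
      push_cast
      constructor <;> linarith
    · have : (l : ℚ) ≤ j := by exact_mod_cast (not_lt.mp h)
      push_cast
      constructor <;> linarith
  have key : ∀ d : ℤ, (d * p + 1 ≤ (e : ℤ) + l - j) → ((e : ℤ) + l - j ≤ (d + 1) * p) →
      ⌊((n : ℚ) + (p : ℚ) * (l : ℚ) - 1 - (j : ℚ) * ((p : ℚ) + 1)) /
          ((p : ℚ) * ((p : ℚ) + 1))⌋ = L + d := by
    intro d h1 h2
    have h1' : (d : ℚ) * p + 1 ≤ (e : ℚ) + l - j := by exact_mod_cast h1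
    have h2' : (e : ℚ) + l - j ≤ ((d : ℚ) + 1) * p := by exact_mod_cast h2
    have hn' : (n : ℚ) = L * (p * (p + 1)) + e * (p + 1) + l := by exact_mod_cast hn
    rw [Int.floor_eq_iff, le_div_iff₀ (by positivity), div_lt_iff₀ (by positivity), hn']
    push_cast
    have h3 := mul_le_mul_of_nonneg_right h1' hp1.le
    have h4 := mul_le_mul_of_nonneg_right h2' hp1.le
    constructor <;> nlinarith
  rw [Int.card_Icc, hc]
  by_cases a : j < e + l
  · by_cases b : p + j < e + l
    · rw [key 1 (by omega) (by omega)]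
      split_ifs <;> omega
    · rw [key 0 (by omega) (by omega)]
      split_ifs <;> omega
  · rw [key (-1) (by omega) (by omega)]
    split_ifs <;> omega

lemma Zdeg_eq_aux (p n k L e l : ℕ) (hl : l ≤ p) (he : e < p)
    (hn : n = L * (p * (p + 1)) + e * (p + 1) + l) :
    (Zdeg p n k : ℤ) = ∑ j ∈ Finset.Ico k p,
      ((L : ℤ) + (if j < e + l then 1 else 0) + (if p + j < e + l then 1 else 0)
        - (if j < l then 1 else 0)) := by
  have hm : n % (p + 1) = l := by
    rw [hn, show L * (p * (p + 1)) + e * (p + 1) + l = l + (p + 1) * (L * p + e) by ring,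
      Nat.add_mul_mod_self_left, Nat.mod_eq_of_lt (by omega)]
  unfold Zdeg
  rw [hm]
  push_cast
  refine Finset.sum_congr rfl fun j hj => ?_
  exact Zdeg_card_aux p n j L e l (Finset.mem_Ico.mp hj).2 hl he hn

lemma Zdeg_sum_ind (k p c : ℕ) :
    ∑ j ∈ Finset.Ico k p, (if j = c then (1 : ℤ) else 0) = if k ≤ c ∧ c < p then 1 else 0 := by
  rw [Finset.sum_ite_eq']
  simp

lemma Zdeg_sum_ind' (k p c : ℕ) :
    ∑ j ∈ Finset.Ico k p, (if p + j = c then (1 : ℤ) else 0)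
      = if p + k ≤ c ∧ c < p + p then 1 else 0 := by
  by_cases h : p ≤ c
  · have : ∀ j, (p + j = c) = (j = c - p) := fun j => by
      apply propext
      omega
    simp only [this, Zdeg_sum_ind]
    congr 1
    apply propext
    omega
  · rw [if_neg (by omega)]
    exact Finset.sum_eq_zero fun j _ => if_neg (by omega)

lemma Zdeg_diff_aux (p n k L e l : ℕ) (hl : l < p) (he : e < p)
    (hn : n = L * (p * (p + 1)) + e * (p + 1) + l) :
    (Zdeg p (n + 1) k : ℤ) - (Zdeg p n k : ℤ) =
      (if k ≤ e + l ∧ e + l < p then 1 else 0) + (if p + k ≤ e + l ∧ e + l < p + p then 1 else 0)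
        - (if k ≤ l ∧ l < p then 1 else 0) := by
  rw [Zdeg_eq_aux p n k L e l hl.le he hn, Zdeg_eq_aux p (n + 1) k L e (l + 1) hl he (by omega),
    ← Zdeg_sum_ind', ← Zdeg_sum_ind k p (e + l), ← Zdeg_sum_ind k p l, ← Finset.sum_sub_distrib,
    ← Finset.sum_add_distrib, ← Finset.sum_sub_distrib]
  refine Finset.sum_congr rfl fun j _ => ?_
  split_ifs <;> omega

/-- **Values of `Z(n+1,k) - Z(n,k)` when `ℓ(n) < p`** (Lemma `lem:valuesdiffZnk`,
(eq:values:diffZnk:1)).  Here `ℓ(n) = n % (p+1)` and `η(n) = (n % (p(p+1))) / (p+1)`. -/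
theorem Zdeg_diff_values_ell_lt_p (p : ℕ) (hp : 1 ≤ p) (k : ℕ) (hk : k < p) (n : ℕ)
    (hl : n % (p + 1) < p) :
    (n % (p + 1) < k →
      ¬(k ≤ n % (p * (p + 1)) / (p + 1) + n % (p + 1) ∧
          n % (p * (p + 1)) / (p + 1) + n % (p + 1) < p) →
      (Zdeg p (n + 1) k : ℤ) - (Zdeg p n k : ℤ) = 0) ∧
    (n % (p + 1) < k →
      (k ≤ n % (p * (p + 1)) / (p + 1) + n % (p + 1) ∧
          n % (p * (p + 1)) / (p + 1) + n % (p + 1) < p) →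
      (Zdeg p (n + 1) k : ℤ) - (Zdeg p n k : ℤ) = 1) ∧
    (k ≤ n % (p + 1) →
      ¬(p ≤ n % (p * (p + 1)) / (p + 1) + n % (p + 1) ∧
          n % (p * (p + 1)) / (p + 1) + n % (p + 1) < p + k) →
      (Zdeg p (n + 1) k : ℤ) - (Zdeg p n k : ℤ) = 0) ∧
    (k ≤ n % (p + 1) →
      (p ≤ n % (p * (p + 1)) / (p + 1) + n % (p + 1) ∧
          n % (p * (p + 1)) / (p + 1) + n % (p + 1) < p + k) →
      (Zdeg p (n + 1) k : ℤ) - (Zdeg p n k : ℤ) = -1) := by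
  have hpos : 0 < p * (p + 1) := by positivity
  have he : n % (p * (p + 1)) / (p + 1) < p :=
    Nat.div_lt_of_lt_mul (by rw [mul_comm (p + 1)]; exact Nat.mod_lt _ hpos)
  have hn : n = n / (p * (p + 1)) * (p * (p + 1))
      + n % (p * (p + 1)) / (p + 1) * (p + 1) + n % (p + 1) := by
    have h1 := Nat.div_add_mod' n (p * (p + 1))
    have h2 := Nat.div_add_mod' (n % (p * (p + 1))) (p + 1)
    rw [Nat.mod_mod_of_dvd n (Dvd.intro_left p rfl)] at h2
    omega
  have key := Zdeg_diff_aux p n k _ _ _ hl he hn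
  rw [key]
  generalize n % (p * (p + 1)) / (p + 1) = e at *
  generalize n % (p + 1) = l at *
  clear key hn
  refine ⟨?_, ?_, ?_, ?_⟩ <;> intro h1 h2 <;> split_ifs <;> omega

end
end

section
/- Let k ∈ {0,…,p−1} and let n ≥ 0 be an integer with ℓ(n) = p. Then Z(n+1,k) − Z(n,k) equals 0 if η(n) ∈ {0,…,k−1}, and equals 1 if η(n) ∈ {k,…,p−1}. -/
noncomputable section

theorem Zdeg_diff_values_ell_eq_p (p : ℕ) (hp : 1 ≤ p) (k : ℕ) (hk : k < p) (n : ℕ)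
    (hl : n % (p + 1) = p) :
    (n % (p * (p + 1)) / (p + 1) < k →
      (Zdeg p (n + 1) k : ℤ) - (Zdeg p n k : ℤ) = 0) ∧
    (k ≤ n % (p * (p + 1)) / (p + 1) →
      (Zdeg p (n + 1) k : ℤ) - (Zdeg p n k : ℤ) = 1) := by
  obtain ⟨e, he⟩ : ∃ e, e = n % (p * (p + 1)) / (p + 1) := ⟨_, rfl⟩
  obtain ⟨L, hL⟩ : ∃ L, L = n / (p * (p + 1)) := ⟨_, rfl⟩
  have hep : e < p := by
    rw [he]
    apply Nat.div_lt_of_lt_mul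
    rw [Nat.mul_comm (p + 1) p]
    exact Nat.mod_lt _ (by positivity)
  have hn : n = L * (p * (p + 1)) + e * (p + 1) + p := by
    have h1 := Nat.div_add_mod n (p * (p + 1))
    have h2 := Nat.div_add_mod (n % (p * (p + 1))) (p + 1)
    rw [Nat.mod_mod_of_dvd n (Dvd.intro_left p rfl), hl, ← he] at h2
    rw [← hL, ← h2] at h1
    linarith
  have hl1 : (n + 1) % (p + 1) = 0 := by
    rw [show n + 1 = (p + 1) * (L * p + e + 1) by rw [hn]; ring]
    exact Nat.mul_mod_right _ _
  rw [← he]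
  have hpq : (1 : ℚ) ≤ p := by exact_mod_cast hp
  have hnq : (n : ℚ) = L * (p * (p + 1)) + e * (p + 1) + p := by exact_mod_cast hn
  have heq : (e : ℚ) + 1 ≤ p := by exact_mod_cast hep
  have he0 : (0 : ℚ) ≤ e := by positivity
  have key : Zdeg p (n + 1) k = Zdeg p n k + ∑ j ∈ Finset.Ico k p, if e = j then 1 else 0 := by
    unfold Zdeg
    rw [← Finset.sum_add_distrib]
    apply Finset.sum_congr rfl
    intro j hj
    have hjp : j < p := (Finset.mem_Ico.mp hj).2
    have hjq : (j : ℚ) + 1 ≤ p := by exact_mod_cast hjp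
    have hj0 : (0 : ℚ) ≤ j := by positivity
    have hD : (0 : ℚ) < p * (p + 1) := by positivity
    have hE : (0 : ℚ) < p + 1 := by positivity
    rw [hl, hl1]
    have c1 : ⌈((p : ℕ) - (j : ℚ)) / ((p : ℚ) + 1)⌉ = 1 := by
      rw [Int.ceil_eq_iff, lt_div_iff₀ hE, div_le_iff₀ hE]
      push_cast
      constructor <;> linarith
    have c2 : ⌈(((0 : ℕ) : ℚ) - (j : ℚ)) / ((p : ℚ) + 1)⌉ = 0 := by
      rw [Int.ceil_eq_iff, lt_div_iff₀ hE, div_le_iff₀ hE]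
      push_cast
      constructor <;> linarith
    have f1 : ⌊((n : ℚ) + (p : ℚ) * ((p : ℕ) : ℚ) - 1 - (j : ℚ) * ((p : ℚ) + 1)) /
          ((p : ℚ) * ((p : ℚ) + 1))⌋ = (L : ℤ) + if j < e then 1 else 0 := by
      rw [Int.floor_eq_iff, le_div_iff₀ hD, div_lt_iff₀ hD, hnq]
      split_ifs with h
      · have h' : (j : ℚ) + 1 ≤ e := by exact_mod_cast h
        push_cast
        constructor <;> nlinarith
      · have h' : (e : ℚ) ≤ j := by exact_mod_cast not_lt.mp h
        push_cast
        constructor <;> nlinarith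
    have f2 : ⌊(((n + 1 : ℕ) : ℚ) + (p : ℚ) * ((0 : ℕ) : ℚ) - 1 - (j : ℚ) * ((p : ℚ) + 1)) /
          ((p : ℚ) * ((p : ℚ) + 1))⌋ = (L : ℤ) + if j ≤ e then 0 else -1 := by
      rw [Int.floor_eq_iff, le_div_iff₀ hD, div_lt_iff₀ hD]
      push_cast
      rw [hnq]
      split_ifs with h
      · have h' : (j : ℚ) ≤ e := by exact_mod_cast h
        push_cast
        constructor <;> nlinarith
      · have h' : (e : ℚ) + 1 ≤ j := by exact_mod_cast not_le.mp h
        push_cast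
        constructor <;> nlinarith
    rw [c1, c2, f1, f2, Int.card_Icc, Int.card_Icc]
    split_ifs <;> omega
  rw [key, Finset.sum_ite_eq]
  simp only [Finset.mem_Ico]
  constructor
  · intro h
    rw [if_neg (by omega)]
    simp
  · intro h
    rw [if_pos ⟨h, hep⟩]
    simp

end
end

section
/- Let k ∈ {1,…,p−1} and n ≥ 0. Then Z(n+1,k) − Z(n,k) ≤ Z(n+1,k−1) − Z(n,k−1) + c, where c = 1 if ℓ(n) = k−1 and c = 0 otherwise (i.e., c = 0 if ℓ(n) ∈ {0,…,k−2} or ℓ(n) ∈ {k,…,p}). -/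
noncomputable section

/-- The summand `M_j(n)`. -/
def Mdeg (p n j : ℕ) : ℕ :=
    (Finset.Icc
      (⌈(((n % (p + 1) : ℕ) : ℚ) - (j : ℚ)) / ((p : ℚ) + 1)⌉)
      (⌊((n : ℚ) + (p : ℚ) * ((n % (p + 1) : ℕ) : ℚ) - 1 - (j : ℚ) * ((p : ℚ) + 1)) /
          ((p : ℚ) * ((p : ℚ) + 1))⌋)).card

theorem Mdeg_eq (p q l j : ℕ) (hp : 1 ≤ p) (hl : l ≤ p) (hj : j < p) :
    Mdeg p ((p + 1) * q + l) j =
      (((q : ℤ) + l - j - 1) / p + 1 - (if j < l then 1 else 0)).toNat := by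
  have hmod : ((p + 1) * q + l) % (p + 1) = l := by
    rw [Nat.mul_add_mod, Nat.mod_eq_of_lt (by omega)]
  have hpq : (0 : ℚ) < p := by exact_mod_cast hp
  have hlo : ⌈((l : ℚ) - (j : ℚ)) / ((p : ℚ) + 1)⌉ = if j < l then 1 else 0 := by
    have hlq : (l : ℚ) ≤ p := by exact_mod_cast hl
    have hjq : (j : ℚ) < p := by exact_mod_cast hj
    have hl0 : (0 : ℚ) ≤ l := by positivity
    have hj0 : (0 : ℚ) ≤ j := by positivity
    rw [Int.ceil_eq_iff]
    split_ifs with h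
    · have h' : (j : ℚ) < l := by exact_mod_cast h
      rw [lt_div_iff₀ (by positivity), div_le_iff₀ (by positivity)]
      push_cast
      constructor <;> linarith
    · have h' : (l : ℚ) ≤ j := by exact_mod_cast not_lt.mp h
      rw [lt_div_iff₀ (by positivity), div_le_iff₀ (by positivity)]
      push_cast
      constructor <;> linarith
  have hup : ⌊((((p + 1) * q + l : ℕ) : ℚ) + (p : ℚ) * (l : ℚ) - 1 - (j : ℚ) * ((p : ℚ) + 1)) /
          ((p : ℚ) * ((p : ℚ) + 1))⌋ = ((q : ℤ) + l - j - 1) / p := by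
    have hpz : (0 : ℤ) < p := by exact_mod_cast hp
    have h1 := Int.mul_ediv_self_le (x := (q : ℤ) + l - j - 1) (k := (p : ℤ)) hpz.ne'
    have h2 := Int.lt_mul_ediv_self_add (x := (q : ℤ) + l - j - 1) (k := (p : ℤ)) hpz
    generalize ((q : ℤ) + l - j - 1) / p = d at *
    have h2' : (q : ℤ) + l - j ≤ p * d + p := by linarith
    have h1q : (p : ℚ) * d ≤ (q : ℚ) + l - j - 1 := by exact_mod_cast h1
    have h2q : (q : ℚ) + l - j ≤ p * d + p := by exact_mod_cast h2'
    have h3 := mul_le_mul_of_nonneg_left h1q (by positivity : (0 : ℚ) ≤ (p : ℚ) + 1)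
    have h4 := mul_le_mul_of_nonneg_left h2q (by positivity : (0 : ℚ) ≤ (p : ℚ) + 1)
    rw [Int.floor_eq_iff, le_div_iff₀ (by positivity), div_lt_iff₀ (by positivity)]
    push_cast
    constructor <;> nlinarith
  unfold Mdeg
  rw [hmod, hlo, hup, Int.card_Icc]

theorem Mdeg_step (p n j : ℕ) (hp : 1 ≤ p) (hj : j < p) :
    (Mdeg p n j : ℤ) ≤ Mdeg p (n + 1) j + (if n % (p + 1) = j then 1 else 0) := by
  have hn := Nat.div_add_mod n (p + 1)
  have hl : n % (p + 1) < p + 1 := Nat.mod_lt _ (by omega)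
  have hpz : (0 : ℤ) < p := by exact_mod_cast hp
  generalize n / (p + 1) = q at *
  generalize n % (p + 1) = l at *
  subst hn
  rw [Mdeg_eq p q l j hp (by omega) hj]
  rcases Nat.lt_or_ge l p with h | h
  · rw [add_assoc, Mdeg_eq p q (l + 1) j hp (by omega) hj]
    have := Int.ediv_le_ediv hpz
      (show (q : ℤ) + l - j - 1 ≤ (q : ℤ) + (l + 1 : ℕ) - j - 1 by push_cast; linarith)
    split_ifs <;> omega
  · obtain rfl : l = p := by omega
    have e : (l + 1) * q + l + 1 = (l + 1) * (q + 1) + 0 := by ring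
    rw [e, Mdeg_eq l (q + 1) 0 j hp (by omega) hj]
    have h1 : ((q : ℤ) + l - j - 1) / l = ((q : ℤ) - j - 1) / l + 1 := by
      have e2 : (q : ℤ) + l - j - 1 = ((q : ℤ) - j - 1) + l := by ring
      rw [e2, Int.add_ediv_of_dvd_right (dvd_refl _), Int.ediv_self hpz.ne']
    have := Int.ediv_le_ediv hpz
      (show (q : ℤ) - j - 1 ≤ ((q + 1 : ℕ) : ℤ) + (0 : ℕ) - j - 1 by push_cast; linarith)
    rw [h1]
    split_ifs <;> omega

/-- **Comparison of consecutive differences** ((eq:rel:diffZnk)).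
For `k ∈ {1,…,p-1}`,
`Z(n+1,k) - Z(n,k) ≤ Z(n+1,k-1) - Z(n,k-1) + c`,
where `c = 1` if `ℓ(n) = k-1` and `c = 0` otherwise. -/
theorem Zdeg_diff_rel (p : ℕ) (hp : 1 ≤ p) (k : ℕ) (hk1 : 1 ≤ k) (hk : k < p) (n : ℕ) :
    (Zdeg p (n + 1) k : ℤ) - (Zdeg p n k : ℤ) ≤
      (Zdeg p (n + 1) (k - 1) : ℤ) - (Zdeg p n (k - 1) : ℤ) +
        (if n % (p + 1) = k - 1 then 1 else 0) := by
  obtain ⟨j, rfl⟩ : ∃ j, k = j + 1 := ⟨k - 1, by omega⟩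
  have hz : ∀ m, Zdeg p m j = Mdeg p m j + Zdeg p m (j + 1) := by
    intro m
    exact Finset.sum_eq_sum_Ico_succ_bot (by omega) (fun j => Mdeg p m j)
  have h := Mdeg_step p n j hp (by omega)
  simp only [Nat.add_sub_cancel]
  rw [hz n, hz (n + 1)]
  push_cast
  linarith

end
end
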